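/- Let 0 < R ≤ ∞, I = [0,R), and f : I → ℝ. Then the following are equivalent: (a) for all n ≥ 1, f[a·1_{n×n} + u uᵀ] ∈ P_n for every a ∈ I and every u ∈ [0, √(R−a))^n; (b) f is absolutely monotonic on (0,R) and 0 ≤ f(0) ≤ f⁺(0), where f⁺(0) := lim_{x→0⁺} f(x) (which exists under either hypothesis). Similarly, the following are equivalent: (1) f is right-continuous at 0 and, for all n ≥ 1, f[a·1_{n×n} + u uᵀ] ∈ P_n for every a ∈ I and every u ∈ [0, √(R−a))^n; (2) for all n ≥ 1, f[A] ∈ P_n for every A ∈ P_n(I); (3) f is absolutely monotonic on [0,R). -/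

import Mathlib

open Matrix Set Filter

/-- A function is absolutely monotonic on an interval `I` if it is continuous on `I`,
infinitely differentiable on the interior of `I`, and all its derivatives are
nonnegative on the interior of `I`. -/
def AbsolutelyMonotonicOn (f : ℝ → ℝ) (I : Set ℝ) : Prop :=
  ContinuousOn f I ∧ ContDiffOn ℝ (⊤ : ℕ∞) f (interior I) ∧
    ∀ (k : ℕ), ∀ x ∈ interior I, 0 ≤ iteratedDerivWithin k f (interior I) x

/-- quadratic form description of positive semidefiniteness over the reals -/
lemma psd_iff {n : ℕ} (M : Matrix (Fin n) (Fin n) ℝ) :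
    M.PosSemidef ↔ (∀ i j, M i j = M j i) ∧
      ∀ v : Fin n → ℝ, 0 ≤ ∑ i, ∑ j, v i * v j * M i j := by
  rw [posSemidef_iff_dotProduct_mulVec]
  have key : ∀ v : Fin n → ℝ, star v ⬝ᵥ (M *ᵥ v) = ∑ i, ∑ j, v i * v j * M i j := by
    intro v
    simp only [dotProduct, mulVec, Finset.mul_sum]
    refine Finset.sum_congr rfl fun i _ => Finset.sum_congr rfl fun j _ => ?_
    simp
    ring
  constructor
  · rintro ⟨h1, h2⟩
    refine ⟨fun i j => ?_, fun v => key v ▸ h2 v⟩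
    have := h1.apply j i
    simpa using this
  · rintro ⟨h1, h2⟩
    refine ⟨?_, fun v => (key v).symm ▸ h2 v⟩
    ext i j
    simpa using (h1 j i)

/-- all derivatives are nonnegative on a bounded open interval -/
def AMI (g : ℝ → ℝ) (α β : ℝ) : Prop :=
  ContDiffOn ℝ (⊤ : ℕ∞) g (Ioo α β) ∧ ∀ (k : ℕ), ∀ x ∈ Ioo α β, 0 ≤ iteratedDeriv k g x

lemma iterWithin_eq {g : ℝ → ℝ} {α β c x : ℝ} (hg : ContDiffOn ℝ (⊤ : ℕ∞) g (Ioo α β))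
    (hc : α < c) (hcx : c < x) (hx : x < β) (k : ℕ) {y : ℝ} (hy : y ∈ Icc c x) :
    iteratedDerivWithin k g (uIcc c x) y = iteratedDeriv k g y := by
  rw [iteratedDeriv_eq_iteratedFDeriv, iteratedDerivWithin_eq_iteratedFDerivWithin,
    iteratedFDerivWithin_eq_iteratedFDeriv (uniqueDiffOn_uIcc hcx.ne) _ (by
      rw [uIcc_of_le hcx.le]; exact hy)]
  have : ContDiffAt ℝ (⊤ : ℕ∞) g y :=
    hg.contDiffAt (Ioo_mem_nhds (lt_of_lt_of_le hc hy.1) (lt_of_le_of_lt hy.2 hx))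
  exact this.of_le (by exact_mod_cast le_top)

lemma taylorEval_eq {g : ℝ → ℝ} {α β c x : ℝ} (hg : ContDiffOn ℝ (⊤ : ℕ∞) g (Ioo α β))
    (hc : α < c) (hcx : c < x) (hx : x < β) (n : ℕ) :
    taylorWithinEval g n (uIcc c x) c x =
      ∑ k ∈ Finset.range (n + 1), iteratedDeriv k g c / (k.factorial : ℝ) * (x - c) ^ k := by
  rw [taylor_within_apply]
  refine Finset.sum_congr rfl fun k _ => ?_
  rw [iterWithin_eq hg hc hcx hx k ⟨le_rfl, hcx.le⟩, smul_eq_mul]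
  ring

lemma AMI.lagrange {g : ℝ → ℝ} {α β c x : ℝ} (hg : ContDiffOn ℝ (⊤ : ℕ∞) g (Ioo α β))
    (hc : α < c) (hcx : c < x) (hx : x < β) (n : ℕ) :
    ∃ ξ ∈ Ioo c x, g x =
      ∑ k ∈ Finset.range (n + 1), iteratedDeriv k g c / (k.factorial : ℝ) * (x - c) ^ k
      + iteratedDeriv (n + 1) g ξ * (x - c) ^ (n + 1) / ((n + 1).factorial : ℝ) := by
  have hsub : uIcc c x ⊆ Ioo α β := by
    rw [uIcc_of_le hcx.le]; exact Icc_subset_Ioo hc hx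
  have h1 : ContDiffOn ℝ (n + 1) g (uIcc c x) := (hg.mono hsub).of_le (by exact_mod_cast le_top)
  obtain ⟨ξ, hξ, h⟩ := taylor_mean_remainder_lagrange_iteratedDeriv hcx.ne h1
  rw [uIoo_of_le hcx.le] at hξ
  refine ⟨ξ, hξ, ?_⟩
  rw [taylorEval_eq hg hc hcx hx] at h
  linarith

lemma AMI.cauchy {g : ℝ → ℝ} {α β c x : ℝ} (hg : ContDiffOn ℝ (⊤ : ℕ∞) g (Ioo α β))
    (hc : α < c) (hcx : c < x) (hx : x < β) (n : ℕ) :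
    ∃ ξ ∈ Ioo c x, g x =
      ∑ k ∈ Finset.range (n + 1), iteratedDeriv k g c / (k.factorial : ℝ) * (x - c) ^ k
      + iteratedDeriv (n + 1) g ξ * (x - ξ) ^ n / (n.factorial : ℝ) * (x - c) := by
  have hsub : uIcc c x ⊆ Ioo α β := by
    rw [uIcc_of_le hcx.le]; exact Icc_subset_Ioo hc hx
  have h1 : ContDiffOn ℝ (n + 1) g (uIcc c x) := (hg.mono hsub).of_le (by exact_mod_cast le_top)
  have hd : DifferentiableOn ℝ (iteratedDerivWithin n g (uIcc c x)) (uIcc c x) := by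
    refine h1.differentiableOn_iteratedDerivWithin ?_ (uniqueDiffOn_uIcc hcx.ne)
    norm_cast
    simp
  obtain ⟨ξ, hξ, h⟩ := taylor_mean_remainder_cauchy hcx.ne h1.of_succ
    (hd.mono Ioo_subset_Icc_self)
  rw [uIoo_of_le hcx.le] at hξ
  refine ⟨ξ, hξ, ?_⟩
  rw [taylorEval_eq hg hc hcx hx, iterWithin_eq hg hc hcx hx _ ⟨hξ.1.le, hξ.2.le⟩] at h
  linarith

lemma AMI.coef_le {g : ℝ → ℝ} {α β c x : ℝ} (hg : AMI g α β)
    (hc : α < c) (hcx : c < x) (hx : x < β) (k : ℕ) :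
    iteratedDeriv k g c / (k.factorial : ℝ) * (x - c) ^ k ≤ g x := by
  obtain ⟨ξ, hξ, h⟩ := AMI.lagrange hg.1 hc hcx hx k
  have hpos : 0 < x - c := sub_pos.2 hcx
  have h2 : iteratedDeriv k g c / (k.factorial : ℝ) * (x - c) ^ k ≤
      ∑ k ∈ Finset.range (k + 1), iteratedDeriv k g c / (k.factorial : ℝ) * (x - c) ^ k := by
    refine Finset.single_le_sum
      (f := fun k => iteratedDeriv k g c / (k.factorial : ℝ) * (x - c) ^ k) (fun i _ => ?_)
      (Finset.mem_range.2 (Nat.lt_succ_self k))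
    have := hg.2 i c ⟨hc, hcx.trans hx⟩
    positivity
  have h3 : 0 ≤ iteratedDeriv (k + 1) g ξ * (x - c) ^ (k + 1) / ((k + 1).factorial : ℝ) := by
    have := hg.2 (k + 1) ξ ⟨hc.trans hξ.1, hξ.2.trans hx⟩
    positivity
  linarith

lemma AMI.mono {g : ℝ → ℝ} {α β c x : ℝ} (hg : AMI g α β)
    (hc : α < c) (hcx : c ≤ x) (hx : x < β) : g c ≤ g x := by
  rcases hcx.eq_or_lt with rfl | h
  · exact le_rfl
  · simpa using hg.coef_le hc h hx 0

lemma AMI.hasSum {g : ℝ → ℝ} {α β c x : ℝ} (hg : AMI g α β)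
    (hc : α < c) (hcx : c ≤ x) (hx : x < β) :
    HasSum (fun k => iteratedDeriv k g c / (k.factorial : ℝ) * (x - c) ^ k) (g x) := by
  rcases hcx.eq_or_lt with rfl | hcx
  · convert hasSum_single 0 _ using 1
    · simp
    · intro k hk
      simp [hk]
  have hpos : 0 < x - c := sub_pos.2 hcx
  obtain ⟨y, hxy, hy⟩ := exists_between hx
  have hnn : ∀ k, 0 ≤ iteratedDeriv k g c / (k.factorial : ℝ) * (x - c) ^ k := by
    intro k
    have := hg.2 k c ⟨hc, hcx.trans hx⟩
    positivity
  rw [hasSum_iff_tendsto_nat_of_nonneg hnn]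
  rw [← tendsto_add_atTop_iff_nat 1]
  set q : ℝ := (x - c) / (y - c) with hq
  have hyc : 0 < y - c := by linarith
  have hyx : 0 < y - x := by linarith
  have hq0 : 0 ≤ q := by positivity
  have hq1 : q < 1 := by rw [hq, div_lt_one hyc]; linarith
  have hgy : 0 ≤ g y := by simpa using hg.2 0 y ⟨by linarith, hy⟩
  set K : ℝ := (x - c) / (y - x) * g y with hK
  have hlim : Tendsto (fun n : ℕ => K * ((n : ℝ) * q ^ n + q ^ n)) atTop (nhds 0) := by
    have h1 := tendsto_self_mul_const_pow_of_lt_one hq0 hq1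
    have h2 := tendsto_pow_atTop_nhds_zero_of_lt_one hq0 hq1
    simpa using (h1.add h2).const_mul K
  have hbd : ∀ n : ℕ, g x - K * ((n : ℝ) * q ^ n + q ^ n) ≤
      ∑ k ∈ Finset.range (n + 1), iteratedDeriv k g c / (k.factorial : ℝ) * (x - c) ^ k ∧
      ∑ k ∈ Finset.range (n + 1), iteratedDeriv k g c / (k.factorial : ℝ) * (x - c) ^ k ≤ g x := by
    intro n
    obtain ⟨ξ, hξ, h⟩ := AMI.cauchy hg.1 hc hcx hx n
    have hd := hg.2 (n + 1) ξ ⟨hc.trans hξ.1, hξ.2.trans hx⟩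
    have hxξ : 0 < x - ξ := sub_pos.2 hξ.2
    have hyξ : 0 < y - ξ := by linarith
    have hrem : 0 ≤ iteratedDeriv (n + 1) g ξ * (x - ξ) ^ n / (n.factorial : ℝ) * (x - c) := by
      positivity
    have hcl := hg.coef_le (hc.trans hξ.1) (hξ.2.trans hxy) hy (n + 1)
    have hr : (x - ξ) / (y - ξ) ≤ q := by
      rw [hq, div_le_div_iff₀ hyξ hyc]
      nlinarith [hξ.1, hξ.2]
    have hrn : ((x - ξ) / (y - ξ)) ^ n ≤ q ^ n := pow_le_pow_left₀ (by positivity) hr n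
    have heq : iteratedDeriv (n + 1) g ξ * (x - ξ) ^ n / (n.factorial : ℝ) * (x - c) =
        (iteratedDeriv (n + 1) g ξ / ((n + 1).factorial : ℝ) * (y - ξ) ^ (n + 1)) *
          (((n : ℝ) + 1) * ((x - ξ) / (y - ξ)) ^ n) * ((x - c) / (y - ξ)) := by
      rw [Nat.factorial_succ, div_pow]
      push_cast
      have : (n.factorial : ℝ) ≠ 0 := by positivity
      field_simp
      ring
    have hle : iteratedDeriv (n + 1) g ξ * (x - ξ) ^ n / (n.factorial : ℝ) * (x - c) ≤
        K * ((n : ℝ) * q ^ n + q ^ n) := by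
      rw [heq]
      have : (x - c) / (y - ξ) ≤ (x - c) / (y - x) :=
        div_le_div_of_nonneg_left hpos.le hyx (by linarith [hξ.2])
      calc _ ≤ g y * (((n : ℝ) + 1) * q ^ n) * ((x - c) / (y - x)) := by gcongr
        _ = _ := by rw [hK]; ring
    constructor <;> linarith
  refine tendsto_of_tendsto_of_tendsto_of_le_of_le ?_ tendsto_const_nhds
    (fun n => (hbd n).1) (fun n => (hbd n).2)
  simpa using tendsto_const_nhds.sub hlim

lemma psd_one {n : ℕ} : (Matrix.of fun _ _ => 1 : Matrix (Fin n) (Fin n) ℝ).PosSemidef := by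
  rw [psd_iff]
  refine ⟨fun i j => rfl, fun v => ?_⟩
  have : ∑ i, ∑ j, v i * v j * (Matrix.of fun _ _ => 1 : Matrix (Fin n) (Fin n) ℝ) i j
      = (∑ i, v i) ^ 2 := by
    simp [sq, Finset.sum_mul_sum]
  rw [this]; positivity

lemma psd_pow {n : ℕ} {A : Matrix (Fin n) (Fin n) ℝ} (hA : A.PosSemidef) (k : ℕ) :
    (Matrix.of fun i j => A i j ^ k).PosSemidef := by
  induction k with
  | zero => simpa using psd_one
  | succ k ih =>
    have := ih.hadamard hA
    have e : (Matrix.of fun i j => A i j ^ (k + 1)) = (Matrix.of fun i j => A i j ^ k) ⊙ A := by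
      ext i j
      simp [pow_succ]
    rw [e]
    exact this

lemma psd_rank {n : ℕ} (u : Fin n → ℝ) : (Matrix.of fun i j => u i * u j).PosSemidef := by
  rw [psd_iff]
  refine ⟨fun i j => by simp [mul_comm], fun v => ?_⟩
  have : ∑ i, ∑ j, v i * v j * (Matrix.of fun i j => u i * u j) i j = (∑ i, v i * u i) ^ 2 := by
    rw [sq, Finset.sum_mul_sum]
    refine Finset.sum_congr rfl fun i _ => Finset.sum_congr rfl fun j _ => ?_
    simp
    ring
  rw [this]; positivity

lemma psd_const_add {n : ℕ} {A : Matrix (Fin n) (Fin n) ℝ} (hA : A.PosSemidef) {a : ℝ}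
    (ha : 0 ≤ a) : (Matrix.of fun i j => a + A i j).PosSemidef := by
  have := (psd_one (n := n)).smul ha |>.add hA
  convert this using 1
  ext i j
  simp

/-- an absolutely monotonic function preserves positivity of `c + A` -/
lemma AMI.psd {g : ℝ → ℝ} {α β c : ℝ} (hg : AMI g α β) (hc : α < c) {n : ℕ}
    {A : Matrix (Fin n) (Fin n) ℝ} (hA : A.PosSemidef) (hA0 : ∀ i j, 0 ≤ A i j)
    (hA1 : ∀ i j, c + A i j < β) (v : Fin n → ℝ) :
    0 ≤ ∑ i, ∑ j, v i * v j * g (c + A i j) := by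
  have hs : HasSum (fun k => ∑ i, ∑ j, v i * v j *
      (iteratedDeriv k g c / (k.factorial : ℝ) * (c + A i j - c) ^ k))
      (∑ i, ∑ j, v i * v j * g (c + A i j)) :=
    hasSum_sum fun i _ => hasSum_sum fun j _ =>
      (hg.hasSum hc (by linarith [hA0 i j]) (hA1 i j)).mul_left _
  rcases Nat.eq_zero_or_pos n with rfl | hn
  · simp
  refine hs.nonneg fun k => ?_
  have h1 := ((psd_iff _).1 (psd_pow hA k)).2 v
  have hcb : c < β := by linarith [hA0 ⟨0, hn⟩ ⟨0, hn⟩, hA1 ⟨0, hn⟩ ⟨0, hn⟩]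
  have h2 := hg.2 k c ⟨hc, hcb⟩
  have : ∑ i, ∑ j, v i * v j *
      (iteratedDeriv k g c / (k.factorial : ℝ) * (c + A i j - c) ^ k) =
      iteratedDeriv k g c / (k.factorial : ℝ) *
        ∑ i, ∑ j, v i * v j * (Matrix.of fun i j => A i j ^ k) i j := by
    simp only [Finset.mul_sum]
    refine Finset.sum_congr rfl fun i _ => Finset.sum_congr rfl fun j _ => ?_
    simp
    ring
  rw [this]
  positivity

lemma exists_vandermonde_vec (k : ℕ) :
    ∃ v : Fin (k + 1) → ℝ, ∀ m ≤ k,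
      ∑ i, v i * ((i : ℕ) + 1 : ℝ) ^ m = if m = k then 1 else 0 := by
  set w : Fin (k + 1) → ℝ := fun i => ((i : ℕ) + 1 : ℝ) with hw
  have hinj : Function.Injective w := by
    intro i j h
    simp only [hw] at h
    have h2 : ((i : ℕ) : ℝ) = ((j : ℕ) : ℝ) := by linarith
    exact Fin.ext (by exact_mod_cast h2)
  have hdet : IsUnit (Matrix.vandermonde w).det :=
    isUnit_iff_ne_zero.2 (Matrix.det_vandermonde_ne_zero_iff.2 hinj)
  set e : Fin (k + 1) → ℝ := fun m => if (m : ℕ) = k then 1 else 0 with he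
  refine ⟨e ᵥ* (Matrix.vandermonde w)⁻¹, fun m hm => ?_⟩
  have h : (e ᵥ* (Matrix.vandermonde w)⁻¹) ᵥ* (Matrix.vandermonde w) = e := by
    rw [Matrix.vecMul_vecMul, Matrix.nonsing_inv_mul _ hdet, Matrix.vecMul_one]
  have h2 := congrFun h ⟨m, by omega⟩
  simp only [Matrix.vecMul, dotProduct, Matrix.vandermonde_apply, he] at h2
  exact h2

/-- Loewner's argument: for smooth functions all derivatives are nonnegative. -/
lemma smooth_deriv_nonneg {g : ℝ → ℝ} {α β a : ℝ} (hg : ContDiffOn ℝ (⊤ : ℕ∞) g (Ioo α β))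
    (ha : a ∈ Ioo α β)
    (hP : ∀ (n : ℕ) (u v : Fin n → ℝ), (∀ i, 0 ≤ u i ∧ a + u i * u i < β) →
      0 ≤ ∑ i, ∑ j, v i * v j * g (a + u i * u j)) (k : ℕ) :
    0 ≤ iteratedDeriv k g a := by
  obtain ⟨v, hv⟩ := exists_vandermonde_vec k
  set w : Fin (k + 1) → ℝ := fun i => ((i : ℕ) + 1 : ℝ) with hw
  have hwpos : ∀ i, 0 < w i := fun i => by simp only [hw]; positivity
  have hT := Real.taylor_tendsto (n := k) (convex_Ioo α β) ha
    (hg.of_le (by exact_mod_cast le_top))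
  rw [isOpen_Ioo.nhdsWithin_eq ha] at hT
  set r : ℝ → ℝ := fun x => (g x - taylorWithinEval g k (Ioo α β) a x) / (x - a) ^ k with hr
  set d : ℕ → ℝ := fun m => iteratedDeriv m g a / (m.factorial : ℝ) with hd
  have hexp : ∀ s : ℝ, s ≠ 0 →
      g (a + s) = ∑ m ∈ Finset.range (k + 1), d m * s ^ m + r (a + s) * s ^ k := by
    intro s hs
    have h1 : taylorWithinEval g k (Ioo α β) a (a + s) =
        ∑ m ∈ Finset.range (k + 1), d m * s ^ m := by
      rw [taylor_within_apply]
      refine Finset.sum_congr rfl fun m _ => ?_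
      rw [iteratedDerivWithin_of_isOpen isOpen_Ioo ha, smul_eq_mul]
      simp only [hd, add_sub_cancel_left]
      ring
    simp only [hr, h1, add_sub_cancel_left]
    have : s ^ k ≠ 0 := pow_ne_zero _ hs
    field_simp
    ring
  have hmain : ∀ t : ℝ, t ≠ 0 → ∑ i, ∑ j, v i * v j * g (a + t * (w i * w j)) =
      t ^ k * (d k + ∑ i, ∑ j, v i * v j * (r (a + t * (w i * w j)) * (w i * w j) ^ k)) := by
    intro t ht
    have h1 : ∀ i j, v i * v j * g (a + t * (w i * w j)) =
        ∑ m ∈ Finset.range (k + 1), (d m * t ^ m) * ((v i * w i ^ m) * (v j * w j ^ m)) +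
        t ^ k * (v i * v j * (r (a + t * (w i * w j)) * (w i * w j) ^ k)) := by
      intro i j
      rw [hexp _ (mul_ne_zero ht (mul_pos (hwpos i) (hwpos j)).ne'), mul_add, Finset.mul_sum]
      congr 1
      · refine Finset.sum_congr rfl fun m _ => ?_
        rw [mul_pow, mul_pow]; ring
      · rw [mul_pow]; ring
    simp only [h1, Finset.sum_add_distrib, mul_add]
    congr 1
    · have h2 : ∑ i, ∑ j, ∑ m ∈ Finset.range (k + 1),
          (d m * t ^ m) * ((v i * w i ^ m) * (v j * w j ^ m)) =
          ∑ m ∈ Finset.range (k + 1), (d m * t ^ m) *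
            ((∑ i, v i * w i ^ m) * (∑ j, v j * w j ^ m)) := by
        have h3 : ∀ i, ∑ j, ∑ m ∈ Finset.range (k + 1),
            (d m * t ^ m) * ((v i * w i ^ m) * (v j * w j ^ m)) =
            ∑ m ∈ Finset.range (k + 1), ∑ j,
            (d m * t ^ m) * ((v i * w i ^ m) * (v j * w j ^ m)) := fun i => Finset.sum_comm
        rw [Finset.sum_congr rfl fun i _ => h3 i, Finset.sum_comm]
        refine Finset.sum_congr rfl fun m _ => ?_
        rw [Finset.sum_mul_sum, Finset.mul_sum]
        refine Finset.sum_congr rfl fun i _ => ?_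
        rw [Finset.mul_sum]
      rw [h2, Finset.sum_eq_single k]
      · rw [hv k le_rfl]; simp; ring
      · intro m hm hmk
        rw [hv m (by simpa [Nat.lt_succ_iff] using hm)]
        simp [hmk]
      · simp
    · simp only [Finset.mul_sum]
  have hlim : Tendsto (fun τ : ℝ => d k + ∑ i, ∑ j, v i * v j *
      (r (a + τ ^ 2 * (w i * w j)) * (w i * w j) ^ k)) (nhdsWithin 0 (Ioi 0)) (nhds (d k)) := by
    have h0 : ∀ i j, Tendsto (fun τ : ℝ => v i * v j *
        (r (a + τ ^ 2 * (w i * w j)) * (w i * w j) ^ k)) (nhdsWithin 0 (Ioi 0)) (nhds 0) := by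
      intro i j
      have hc : Tendsto (fun τ : ℝ => a + τ ^ 2 * (w i * w j)) (nhdsWithin 0 (Ioi 0))
          (nhds a) := by
        have : Continuous (fun τ : ℝ => a + τ ^ 2 * (w i * w j)) := by fun_prop
        have h := (this.tendsto 0).mono_left (nhdsWithin_le_nhds (s := Ioi 0))
        simpa using h
      have := ((hT.comp hc).mul_const ((w i * w j) ^ k)).const_mul (v i * v j)
      simpa using this
    have := (tendsto_finsetSum Finset.univ fun i _ =>
      tendsto_finsetSum Finset.univ fun j _ => h0 i j).const_add (d k)
    simpa using this
  have hev : ∀ᶠ τ : ℝ in nhdsWithin 0 (Ioi 0), 0 ≤ d k + ∑ i, ∑ j, v i * v j *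
      (r (a + τ ^ 2 * (w i * w j)) * (w i * w j) ^ k) := by
    have h1 : ∀ᶠ τ : ℝ in nhdsWithin 0 (Ioi 0), ∀ i, a + (τ * w i) * (τ * w i) < β := by
      rw [eventually_all]
      intro i
      have : Continuous (fun τ : ℝ => a + (τ * w i) * (τ * w i)) := by fun_prop
      have h := (this.tendsto 0).mono_left (nhdsWithin_le_nhds (s := Ioi 0))
      exact h.eventually (gt_mem_nhds (by simpa using ha.2))
    filter_upwards [h1, self_mem_nhdsWithin] with τ hτ hτ0
    have hτ0 : 0 < τ := hτ0
    have h2 := hP (k + 1) (fun i => τ * w i) v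
      (fun i => ⟨(mul_pos hτ0 (hwpos i)).le, hτ i⟩)
    have h3 := hmain (τ ^ 2) (by positivity)
    have h4 : ∀ i j, τ * w i * (τ * w j) = τ ^ 2 * (w i * w j) := fun i j => by ring
    simp only [h4] at h2
    rw [h3] at h2
    exact nonneg_of_mul_nonneg_right h2 (by positivity)
  have hdk : 0 ≤ d k := ge_of_tendsto hlim hev
  have : iteratedDeriv k g a = d k * (k.factorial : ℝ) := by
    simp only [hd]
    field_simp
  rw [this]
  positivity

/-- the rank-two positivity hypothesis on `[0,β)` -/
def Hyp (f : ℝ → ℝ) (β : ℝ) : Prop :=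
  ∀ (n : ℕ) (a : ℝ) (u v : Fin n → ℝ), 0 ≤ a → (∀ i, 0 ≤ u i ∧ a + u i * u i < β) →
    0 ≤ ∑ i, ∑ j, v i * v j * f (a + u i * u j)

lemma Hyp.nonneg {f : ℝ → ℝ} {β : ℝ} (h : Hyp f β) {a : ℝ} (ha : 0 ≤ a) (hb : a < β) :
    0 ≤ f a := by
  simpa using h 1 a (fun _ => 0) (fun _ => 1) ha (fun i => by simpa using hb)

lemma Hyp.two {f : ℝ → ℝ} {β : ℝ} (h : Hyp f β) {a s r : ℝ} (ha : 0 ≤ a) (hs : 0 ≤ s)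
    (hr : 0 ≤ r) (hs' : a + s * s < β) (hr' : a + r * r < β) :
    f (a + s * r) ^ 2 ≤ f (a + s * s) * f (a + r * r) := by
  have key : ∀ x y : ℝ, 0 ≤ x * x * f (a + s * s) + 2 * (x * y) * f (a + s * r)
      + y * y * f (a + r * r) := by
    intro x y
    have h1 := h 2 a ![s, r] ![x, y] ha (by
      intro i; fin_cases i
      · exact ⟨hs, hs'⟩
      · exact ⟨hr, hr'⟩)
    simp only [Fin.sum_univ_two, Matrix.cons_val_zero, Matrix.cons_val_one] at h1
    rw [mul_comm r s] at h1
    linarith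
  have hd := discrim_le_zero (a := f (a + s * s)) (b := 2 * f (a + s * r)) (c := f (a + r * r))
    (fun x => by have := key x 1; linarith)
  unfold discrim at hd
  linarith

lemma Hyp.mono {f : ℝ → ℝ} {β : ℝ} (h : Hyp f β) {x y : ℝ} (hx : 0 ≤ x) (hxy : x ≤ y)
    (hy : y < β) : f x ≤ f y := by
  have hsq : √(y - x) * √(y - x) = y - x := Real.mul_self_sqrt (sub_nonneg.2 hxy)
  have h1 := h.two (a := x) (s := 0) (r := √(y - x)) hx le_rfl (Real.sqrt_nonneg _)
    (by linarith) (by linarith)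
  rw [hsq] at h1
  simp only [zero_mul, add_zero, add_sub_cancel] at h1
  have h2 := h.nonneg hx (lt_of_le_of_lt hxy hy)
  have h3 := h.nonneg (hx.trans hxy) hy
  rcases h2.eq_or_lt with h4 | h4
  · rw [← h4]; exact h3
  · nlinarith

/-- truncation of `f` to `[p,q]` -/
def clampF (f : ℝ → ℝ) (p q : ℝ) : ℝ → ℝ := fun x => f (max p (min x q))

lemma clampF_eq {f : ℝ → ℝ} {p q x : ℝ} (h1 : p ≤ x) (h2 : x ≤ q) : clampF f p q x = f x := by
  simp [clampF, h1, h2]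

lemma Hyp.clamp_mono {f : ℝ → ℝ} {β p q : ℝ} (h : Hyp f β) (hp : 0 ≤ p) (hpq : p ≤ q)
    (hq : q < β) : Monotone (clampF f p q) := by
  intro x y hxy
  refine h.mono (hp.trans (le_max_left _ _)) (by gcongr) ?_
  exact lt_of_le_of_lt (max_le hpq (min_le_right _ _)) hq

lemma Hyp.continuousAt {f : ℝ → ℝ} {β : ℝ} (h : Hyp f β) {x : ℝ} (hx : 0 < x) (hxb : x < β) :
    ContinuousAt f x := by
  set p := x / 2
  set q := (x + β) / 2
  have hp : p < x := by simp only [p]; linarith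
  have hp0 : 0 < p := by simp only [p]; linarith
  have hq : x < q := by simp only [q]; linarith
  have hqb : q < β := by simp only [q]; linarith
  have hm := h.clamp_mono hp0.le (hp.le.trans hq.le) hqb
  have heq : ∀ᶠ y in nhds x, clampF f p q y = f y := by
    filter_upwards [Icc_mem_nhds hp hq] with y hy using clampF_eq hy.1 hy.2
  suffices ContinuousAt (clampF f p q) x from this.congr heq
  rw [hm.continuousAt_iff_leftLim_eq_rightLim]
  set F := clampF f p q
  have hl := hm.tendsto_leftLim x
  have hr := hm.tendsto_rightLim x
  have hlr : F.leftLim x ≤ F.rightLim x := hm.leftLim_le_rightLim le_rfl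
  have hF0 : ∀ y, 0 ≤ F y := fun y => h.nonneg (hp0.le.trans (le_max_left _ _))
    (lt_of_le_of_lt (max_le (hp.le.trans hq.le) (min_le_right _ _)) hqb)
  have hl0 : 0 ≤ F.leftLim x := ge_of_tendsto hl (Eventually.of_forall hF0)
  have tend : ∀ φ : ℝ → ℝ, ContinuousAt φ 1 → φ 1 = x →
      Tendsto φ (nhdsWithin 1 (Ioi 1)) (nhds x) := by
    intro φ hφ h1
    have := hφ.tendsto.mono_left (nhdsWithin_le_nhds (s := Ioi 1))
    rwa [h1] at this
  have t1 := tend (fun μ => x / μ ^ 2) (by fun_prop (disch := norm_num)) (by norm_num)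
  have t2 := tend (fun μ => x * μ ^ 2) (by fun_prop) (by norm_num)
  have t3 := tend (fun μ => x * μ ^ 6) (by fun_prop) (by norm_num)
  have hgt : ∀ᶠ μ : ℝ in nhdsWithin 1 (Ioi 1), 1 < μ := self_mem_nhdsWithin
  have s1 : Tendsto (fun μ : ℝ => x / μ ^ 2) (nhdsWithin 1 (Ioi 1)) (nhdsWithin x (Iio x)) := by
    refine tendsto_nhdsWithin_of_tendsto_nhds_of_eventually_within _ t1 ?_
    filter_upwards [hgt] with μ hμ
    exact div_lt_self hx (one_lt_pow₀ hμ (by norm_num))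
  have s2 : Tendsto (fun μ : ℝ => x * μ ^ 2) (nhdsWithin 1 (Ioi 1)) (nhdsWithin x (Ioi x)) := by
    refine tendsto_nhdsWithin_of_tendsto_nhds_of_eventually_within _ t2 ?_
    filter_upwards [hgt] with μ hμ
    exact lt_mul_of_one_lt_right hx (one_lt_pow₀ hμ (by norm_num))
  have s3 : Tendsto (fun μ : ℝ => x * μ ^ 6) (nhdsWithin 1 (Ioi 1)) (nhdsWithin x (Ioi x)) := by
    refine tendsto_nhdsWithin_of_tendsto_nhds_of_eventually_within _ t3 ?_
    filter_upwards [hgt] with μ hμ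
    exact lt_mul_of_one_lt_right hx (one_lt_pow₀ hμ (by norm_num))
  have hineq : (F.rightLim x) ^ 2 ≤ F.leftLim x * F.rightLim x := by
    refine le_of_tendsto_of_tendsto ((hr.comp s2).pow 2) ((hl.comp s1).mul (hr.comp s3)) ?_
    filter_upwards [hgt, t1.eventually (Icc_mem_nhds hp hq), t2.eventually (Icc_mem_nhds hp hq),
      t3.eventually (Icc_mem_nhds hp hq)] with μ hμ m1 m2 m3
    have hμ0 : 0 < μ := by linarith
    have hxx : √x * √x = x := Real.mul_self_sqrt hx.le
    have e1 : √x / μ * (√x / μ) = x / μ ^ 2 := by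
      rw [div_mul_div_comm, hxx, sq]
    have e2 : √x * μ ^ 3 * (√x * μ ^ 3) = x * μ ^ 6 := by
      calc _ = (√x * √x) * μ ^ 6 := by ring
        _ = _ := by rw [hxx]
    have e3 : √x / μ * (√x * μ ^ 3) = x * μ ^ 2 := by
      calc _ = (√x * √x) * μ ^ 2 := by field_simp
        _ = _ := by rw [hxx]
    have := h.two (a := 0) (s := √x / μ) (r := √x * μ ^ 3) le_rfl (by positivity) (by positivity)
      (by rw [e1]; linarith [m1.2]) (by rw [e2]; linarith [m3.2])
    rw [e1, e2, e3, zero_add, zero_add, zero_add] at this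
    simp only [Function.comp]
    rw [show F (x * μ ^ 2) = _ from clampF_eq m2.1 m2.2,
      show F (x * μ ^ 6) = _ from clampF_eq m3.1 m3.2,
      show F (x / μ ^ 2) = _ from clampF_eq m1.1 m1.2]
    exact this
  refine le_antisymm hlr ?_
  by_contra hcon
  push Not at hcon
  nlinarith

open MeasureTheory in
/-- Mollification preserves the positivity property. -/
lemma Hyp.mollify {f F : ℝ → ℝ} {β p q η : ℝ} (h : Hyp f β) (hp : 0 ≤ p) (hq : q < β)
    (hF : Continuous F) (hFf : ∀ x ∈ Icc p q, F x = f x)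
    (φ : ContDiffBump (0 : ℝ)) (hφ : φ.rOut ≤ η) :
    AMI (convolution (φ.normed volume) F (ContinuousLinearMap.lsmul ℝ ℝ) volume)
      (p + η) (q - η) := by
  have hsm : ContDiff ℝ (⊤ : ℕ∞)
      (convolution (φ.normed volume) F (ContinuousLinearMap.lsmul ℝ ℝ) volume) :=
    φ.hasCompactSupport_normed.contDiff_convolution_left _ φ.contDiff_normed hF.locallyIntegrable
  refine ⟨hsm.contDiffOn, fun k a ha => smooth_deriv_nonneg hsm.contDiffOn ha ?_ k⟩
  intro n u v hu
  have hint : ∀ x, Integrable (fun t => φ.normed volume t * F (x - t)) := by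
    intro x
    refine Continuous.integrable_of_hasCompactSupport ?_ ?_
    · exact φ.continuous_normed.mul (by fun_prop)
    · exact φ.hasCompactSupport_normed.mul_right
  have hc : ∀ x, convolution (φ.normed volume) F (ContinuousLinearMap.lsmul ℝ ℝ) volume x =
      ∫ t, φ.normed volume t * F (x - t) := by
    intro x
    simp [convolution]
  have e : ∑ i, ∑ j, v i * v j *
      convolution (φ.normed volume) F (ContinuousLinearMap.lsmul ℝ ℝ) volume (a + u i * u j) =
      ∫ t, ∑ i, ∑ j, v i * v j * (φ.normed volume t * F (a + u i * u j - t)) := by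
    rw [integral_finsetSum _ fun i _ => integrable_finsetSum _ fun j _ =>
      (hint _).const_mul _]
    refine Finset.sum_congr rfl fun i _ => ?_
    rw [integral_finsetSum _ fun j _ => (hint _).const_mul _]
    refine Finset.sum_congr rfl fun j _ => ?_
    rw [hc, integral_const_mul]
  rw [e]
  refine integral_nonneg fun t => ?_
  show 0 ≤ ∑ i, ∑ j, v i * v j * (φ.normed volume t * F (a + u i * u j - t))
  by_cases ht : φ.normed volume t = 0
  · simp [ht]
  have ht' : t ∈ Metric.ball (0 : ℝ) φ.rOut := by
    rw [← φ.support_normed_eq (μ := volume)]; exact ht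
  rw [mem_ball_zero_iff, Real.norm_eq_abs, abs_lt] at ht'
  have e2 : ∑ i, ∑ j, v i * v j * (φ.normed volume t * F (a + u i * u j - t)) =
      φ.normed volume t * ∑ i, ∑ j, v i * v j * f ((a - t) + u i * u j) := by
    simp only [Finset.mul_sum]
    refine Finset.sum_congr rfl fun i _ => Finset.sum_congr rfl fun j _ => ?_
    have hle : u i * u j ≤ max (u i * u i) (u j * u j) := by
      rcases le_total (u i) (u j) with hij | hij
      · exact le_max_of_le_right (mul_le_mul_of_nonneg_right hij (hu j).1)
      · exact le_max_of_le_left (mul_le_mul_of_nonneg_left hij (hu i).1)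
    have hlt : a + u i * u j < q - η := by
      rcases le_max_iff.1 hle with h1 | h1
      · linarith [(hu i).2]
      · linarith [(hu j).2]
    have h0 : 0 ≤ u i * u j := mul_nonneg (hu i).1 (hu j).1
    rw [hFf _ ⟨by linarith [ha.1], by linarith⟩, show a + u i * u j - t = (a - t) + u i * u j by ring]
    ring
  rw [e2]
  refine mul_nonneg (φ.nonneg_normed t) (h n (a - t) u v (by linarith [ha.1]) fun i => ⟨(hu i).1, ?_⟩)
  linarith [(hu i).2]

lemma smooth_of_series {f : ℝ → ℝ} {c y K p : ℝ} (hcy : c < y) (C : ℕ → ℝ)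
    (hC0 : ∀ k, 0 ≤ C k) (hCK : ∀ k, C k * (y - c) ^ k ≤ K)
    (hf : ∀ x, c ≤ x → x < y → f x = ∑' k, C k * (x - c) ^ k) (hcp : c < p) (hpy : p < y) :
    ContDiffAt ℝ (⊤ : ℕ∞) f p := by
  set P := FormalMultilinearSeries.ofScalars ℝ C with hP
  set ρ : NNReal := ⟨y - c, by linarith⟩ with hρ
  have hρr : (ρ : ENNReal) ≤ P.radius := by
    refine P.le_radius_of_bound K fun k => ?_
    rw [hP, FormalMultilinearSeries.ofScalars_norm, Real.norm_of_nonneg (hC0 k)]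
    exact hCK k
  have hρ0 : (0 : ENNReal) < ρ := by
    have : 0 < ρ := by
      rw [← NNReal.coe_pos]; simp only [hρ]; exact sub_pos.2 hcy
    exact_mod_cast this
  have hb := P.hasFPowerSeriesOnBall (lt_of_lt_of_le hρ0 hρr)
  have han : AnalyticAt ℝ P.sum (p - c) := by
    refine hb.analyticAt_of_mem ?_
    refine Metric.eball_subset_eball hρr ?_
    rw [Metric.mem_eball, edist_zero_right, ← ofReal_norm, Real.norm_of_nonneg (by linarith)]
    rw [ENNReal.ofReal_lt_coe_iff]
    · simp only [hρ]; show p - c < y - c; linarith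
    · linarith
  have h1 : ContDiffAt ℝ (⊤ : ℕ∞) (fun x => P.sum (x - c)) p :=
    ContDiffAt.comp (g := P.sum) (f := fun x : ℝ => x - c) p han.contDiffAt (by fun_prop)
  refine h1.congr_of_eventuallyEq ?_
  filter_upwards [Ioo_mem_nhds hcp hpy] with x hx
  rw [hf x hx.1.le hx.2]
  show _ = P.sum (x - c)
  simp [FormalMultilinearSeries.sum, hP, mul_comm]

open MeasureTheory in
lemma Hyp.contDiffAt {f : ℝ → ℝ} {β : ℝ} (h : Hyp f β) {p : ℝ} (hp : 0 < p) (hpb : p < β) :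
    ContDiffAt ℝ (⊤ : ℕ∞) f p := by
  set q := (p + β) / 2 with hqdef
  have hq : p < q := by linarith
  have hqb : q < β := by linarith
  set p0 := p / 4 with hp0
  set c := p / 2 with hc
  set y := (p + q) / 2 with hy
  set η := min (p / 8) ((q - p) / 4) with hη
  have hη0 : 0 < η := lt_min (by linarith) (by linarith)
  have hη1 : η ≤ p / 8 := min_le_left _ _
  have hη2 : η ≤ (q - p) / 4 := min_le_right _ _
  set F := clampF f p0 q with hFdef
  have hFc : Continuous F := by
    rw [continuous_iff_continuousAt]
    intro x
    have h1 : ContinuousAt f (max p0 (min x q)) :=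
      h.continuousAt (lt_of_lt_of_le (by linarith) (le_max_left _ _))
        (lt_of_le_of_lt (max_le (by linarith) (min_le_right _ _)) hqb)
    exact ContinuousAt.comp (g := f) (f := fun x => max p0 (min x q)) h1 (by fun_prop)
  have hFf : ∀ x ∈ Icc p0 q, F x = f x := fun x hx => clampF_eq hx.1 hx.2
  have hpos : ∀ n : ℕ, 0 < η / ((n : ℝ) + 1) := fun n => by positivity
  set φ : ℕ → ContDiffBump (0 : ℝ) := fun n =>
    ⟨η / ((n : ℝ) + 1) / 2, η / ((n : ℝ) + 1), half_pos (hpos n), half_lt_self (hpos n)⟩ with hφ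
  have hφ0 : Tendsto (fun n => (φ n).rOut) atTop (nhds 0) := by
    have := (tendsto_one_div_add_atTop_nhds_zero_nat (𝕜 := ℝ)).const_mul η
    simpa [hφ, div_eq_mul_inv] using this
  have hφη : ∀ n, (φ n).rOut ≤ η := fun n =>
    div_le_self hη0.le (by linarith [Nat.cast_nonneg (α := ℝ) n])
  set G : ℕ → ℝ → ℝ := fun n =>
    convolution ((φ n).normed volume) F (ContinuousLinearMap.lsmul ℝ ℝ) volume with hG
  have hAM : ∀ n, AMI (G n) (p0 + η) (q - η) := fun n =>
    h.mollify (by linarith) hqb hFc hFf (φ n) (hφη n)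
  have hconv : ∀ x, Tendsto (fun n => G n x) atTop (nhds (F x)) := fun x =>
    ContDiffBump.convolution_tendsto_right_of_continuous hφ0 hFc x
  have hcα : p0 + η < c := by linarith
  have hcy : c < y := by linarith
  have hyβ : y < q - η := by linarith
  set U : Ultrafilter ℕ := hyperfilter ℕ with hU
  have hUle : (U : Filter ℕ) ≤ atTop := by
    rw [hU, ← Nat.cofinite_eq_atTop]; exact hyperfilter_le_cofinite
  set K := F y + 1 with hK
  have hev : ∀ᶠ n in (U : Filter ℕ), G n y ≤ K :=
    hUle ((hconv y).eventually (ge_mem_nhds (by linarith)))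
  set D : ℕ → ℕ → ℝ := fun n k => iteratedDeriv k (G n) c / (k.factorial : ℝ) with hD
  have hD0 : ∀ n k, 0 ≤ D n k := fun n k => by
    have := (hAM n).2 k c ⟨hcα, by linarith⟩
    simp only [hD]; positivity
  have hyc : 0 < y - c := by linarith
  have hDK : ∀ᶠ n in (U : Filter ℕ), ∀ k, D n k * (y - c) ^ k ≤ K := by
    filter_upwards [hev] with n hn k
    exact ((hAM n).coef_le hcα hcy hyβ k).trans hn
  have hex : ∀ k, ∃ l, Tendsto (fun n => D n k) (U : Filter ℕ) (nhds l) := by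
    intro k
    have hmem : ∀ᶠ n in (U : Filter ℕ), D n k ∈ Icc 0 (K / (y - c) ^ k) := by
      filter_upwards [hDK] with n hn
      exact ⟨hD0 n k, by rw [le_div_iff₀ (by positivity)]; exact hn k⟩
    obtain ⟨l, _, hl⟩ := (isCompact_Icc (a := (0 : ℝ)) (b := K / (y - c) ^ k)).ultrafilter_le_nhds
      (U.map fun n => D n k) (by rw [Filter.le_principal_iff]; exact hmem)
    exact ⟨l, hl⟩
  choose C hC using hex
  have hC0 : ∀ k, 0 ≤ C k := fun k => ge_of_tendsto (hC k) (Eventually.of_forall fun n => hD0 n k)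
  have hCK : ∀ k, C k * (y - c) ^ k ≤ K := fun k =>
    le_of_tendsto ((hC k).mul_const _) (hDK.mono fun n hn => hn k)
  refine smooth_of_series hcy C hC0 hCK ?_ (by linarith) (by linarith)
  intro x hcx hxy
  have hq0 : 0 ≤ (x - c) / (y - c) := div_nonneg (by linarith) hyc.le
  have hq1 : (x - c) / (y - c) < 1 := by rw [div_lt_one hyc]; linarith
  have hsum : Summable fun k : ℕ => K * ((x - c) / (y - c)) ^ k :=
    (summable_geometric_of_lt_one hq0 hq1).mul_left K
  have hlim : Tendsto (fun n => ∑' k, D n k * (x - c) ^ k) (U : Filter ℕ)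
      (nhds (∑' k, C k * (x - c) ^ k)) := by
    refine tendsto_tsum_of_dominated_convergence hsum (fun k => (hC k).mul_const _) ?_
    filter_upwards [hDK] with n hn k
    have hx0 : 0 ≤ x - c := by linarith
    rw [Real.norm_of_nonneg (mul_nonneg (hD0 n k) (pow_nonneg hx0 k))]
    have : D n k * (x - c) ^ k = (D n k * (y - c) ^ k) * ((x - c) / (y - c)) ^ k := by
      rw [div_pow]; field_simp
    rw [this]
    exact mul_le_mul_of_nonneg_right (hn k) (pow_nonneg hq0 k)
  have heq : ∀ n, ∑' k, D n k * (x - c) ^ k = G n x := fun n =>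
    ((hAM n).hasSum hcα hcx (by linarith)).tsum_eq
  simp only [heq] at hlim
  have := tendsto_nhds_unique hlim ((hconv x).mono_left hUle)
  rw [this, hFf x ⟨by linarith, by linarith⟩]

lemma Hyp.ami {f : ℝ → ℝ} {β : ℝ} (h : Hyp f β) : AMI f 0 β := by
  have h1 : ContDiffOn ℝ (⊤ : ℕ∞) f (Ioo 0 β) :=
    fun x hx => (h.contDiffAt hx.1 hx.2).contDiffWithinAt
  exact ⟨h1, fun k x hx => smooth_deriv_nonneg h1 hx (fun n u v hu => h n x u v hx.1.le hu) k⟩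

lemma isOpen_J (R : EReal) : IsOpen {x : ℝ | 0 < x ∧ (x : EReal) < R} :=
  (isOpen_lt continuous_const continuous_id).inter
    (isOpen_lt continuous_coe_real_ereal continuous_const)

lemma interior_I (R : EReal) :
    interior {x : ℝ | 0 ≤ x ∧ (x : EReal) < R} = {x : ℝ | 0 < x ∧ (x : EReal) < R} := by
  apply Subset.antisymm
  · intro x hx
    have hs : {x : ℝ | 0 ≤ x ∧ (x : EReal) < R} ⊆ Ici (0 : ℝ) := fun y hy => hy.1
    have h1 : x ∈ interior (Ici (0 : ℝ)) := interior_mono hs hx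
    rw [interior_Ici] at h1
    exact ⟨h1, (interior_subset hx).2⟩
  · exact interior_maximal (fun y hy => ⟨hy.1.le, hy.2⟩) (isOpen_J R)

lemma amJ_iff (R : EReal) (f : ℝ → ℝ) :
    (∀ β : ℝ, (β : EReal) < R → AMI f 0 β) ↔
      (ContDiffOn ℝ (⊤ : ℕ∞) f {x : ℝ | 0 < x ∧ (x : EReal) < R} ∧
        ∀ (k : ℕ), ∀ x ∈ {x : ℝ | 0 < x ∧ (x : EReal) < R},
          0 ≤ iteratedDerivWithin k f {x : ℝ | 0 < x ∧ (x : EReal) < R} x) := by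
  constructor
  · intro h
    constructor
    · intro x hx
      obtain ⟨b, hb, hbR⟩ := EReal.lt_iff_exists_real_btwn.1 hx.2
      exact ((h b hbR).1.contDiffAt
        (Ioo_mem_nhds hx.1 (by exact_mod_cast hb))).contDiffWithinAt
    · intro k x hx
      obtain ⟨b, hb, hbR⟩ := EReal.lt_iff_exists_real_btwn.1 hx.2
      rw [iteratedDerivWithin_of_isOpen (isOpen_J R) hx]
      exact (h b hbR).2 k x ⟨hx.1, by exact_mod_cast hb⟩
  · rintro ⟨h1, h2⟩ β hβ
    have hsub : Ioo 0 β ⊆ {x : ℝ | 0 < x ∧ (x : EReal) < R} := fun x hx =>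
      ⟨hx.1, lt_trans (by exact_mod_cast hx.2) hβ⟩
    refine ⟨h1.mono hsub, fun k x hx => ?_⟩
    rw [← iteratedDerivWithin_of_isOpen (isOpen_J R) (hsub hx)]
    exact h2 k x (hsub hx)

/-- a common real bound strictly below `R` for finitely many reals below `R` -/
lemma exists_bound {ι : Type*} [Finite ι] (R : EReal) (hR : 0 < R) (x : ι → ℝ)
    (hx : ∀ i, (x i : EReal) < R) : ∃ β : ℝ, (β : EReal) < R ∧ ∀ i, x i < β := by
  cases nonempty_fintype ι
  choose b hb hbR using fun i => EReal.lt_iff_exists_real_btwn.1 (hx i)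
  obtain ⟨b0, _, hb0R⟩ := EReal.lt_iff_exists_real_btwn.1 hR
  by_cases hne : Nonempty ι
  · obtain ⟨i0, hi0⟩ := Finite.exists_max b
    exact ⟨b i0, hbR i0, fun i => lt_of_lt_of_le (by exact_mod_cast hb i) (hi0 i)⟩
  · exact ⟨b0, hb0R, fun i => (hne ⟨i⟩).elim⟩

/-- condition (a) -/
def CondA (R : EReal) (f : ℝ → ℝ) : Prop :=
  ∀ n : ℕ, 1 ≤ n → ∀ a ∈ {x : ℝ | 0 ≤ x ∧ (x : EReal) < R}, ∀ u : Fin n → ℝ,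
    (∀ i, 0 ≤ u i ∧ ((a + u i * u i : ℝ) : EReal) < R) →
    (Matrix.of fun i j => f (a + u i * u j)).PosSemidef

lemma CondA.hyp {R : EReal} {f : ℝ → ℝ} (h : CondA R f) {β : ℝ} (hβ : (β : EReal) < R) :
    Hyp f β := by
  intro n a u v ha hu
  rcases Nat.eq_zero_or_pos n with rfl | hn
  · simp
  have hab : a < β := by nlinarith [hu ⟨0, hn⟩]
  have := h n hn a ⟨ha, lt_trans (by exact_mod_cast hab) hβ⟩ u
    (fun i => ⟨(hu i).1, lt_trans (by exact_mod_cast (hu i).2) hβ⟩)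
  exact ((psd_iff _).1 this).2 v

lemma AMI.sub_const {g : ℝ → ℝ} {α β d : ℝ} (h : AMI g α β) (hd : ∀ x ∈ Ioo α β, d ≤ g x) :
    AMI (fun x => g x - d) α β := by
  refine ⟨h.1.sub contDiffOn_const, fun k x hx => ?_⟩
  rcases k with _ | k
  · simpa using hd x hx
  · have h1 := h.2 (k + 1) x hx
    rw [iteratedDeriv_succ'] at h1 ⊢
    have : deriv (fun x => g x - d) = deriv g := by
      ext y; simp
    rwa [this]

lemma condA_of (R : EReal) (f : ℝ → ℝ) (ham : ∀ β : ℝ, (β : EReal) < R → AMI f 0 β)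
    (hR : 0 < R) {L : ℝ} (hL : Tendsto f (nhdsWithin 0 (Ioi 0)) (nhds L)) (h0 : 0 ≤ f 0)
    (h0L : f 0 ≤ L) : CondA R f := by
  intro n hn a ha u hu
  rw [psd_iff]
  refine ⟨fun i j => by simp [mul_comm], fun v => ?_⟩
  show 0 ≤ ∑ i, ∑ j, v i * v j * f (a + u i * u j)
  obtain ⟨β, hβR, hβ⟩ := exists_bound R hR (fun i => a + u i * u i) (fun i => (hu i).2)
  have hβ2 : ∀ i j, a + u i * u j < β := by
    intro i j
    rcases le_total (u i) (u j) with hij | hij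
    · exact lt_of_le_of_lt
        (add_le_add_right (mul_le_mul_of_nonneg_right hij (hu j).1) a) (hβ j)
    · exact lt_of_le_of_lt
        (add_le_add_right (mul_le_mul_of_nonneg_left hij (hu i).1) a) (hβ i)
  have hnn : ∀ i j, 0 ≤ u i * u j := fun i j => mul_nonneg (hu i).1 (hu j).1
  rcases ha.1.eq_or_lt with ha0 | ha0
  swap
  · exact (ham β hβR).psd ha0 (psd_rank u) hnn hβ2 v
  subst ha0
  simp only [zero_add] at hβ2 ⊢
  have hle : ∀ x ∈ Ioo 0 β, f 0 ≤ f x := by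
    intro x hx
    refine h0L.trans (le_of_tendsto hL ?_)
    filter_upwards [Ioo_mem_nhdsGT hx.1] with y hy
    exact (ham β hβR).mono hy.1 hy.2.le hx.2
  have hg := (ham β hβR).sub_const hle
  set w : Fin n → ℝ := fun i => if u i = 0 then 0 else v i with hw
  have hsplit : ∑ i, ∑ j, v i * v j * f (u i * u j) =
      f 0 * (∑ i, v i) ^ 2 + ∑ i, ∑ j, w i * w j * (f (u i * u j) - f 0) := by
    rw [sq, Finset.sum_mul_sum, Finset.mul_sum, ← Finset.sum_add_distrib]
    refine Finset.sum_congr rfl fun i _ => ?_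
    rw [Finset.mul_sum, ← Finset.sum_add_distrib]
    refine Finset.sum_congr rfl fun j _ => ?_
    by_cases hi : u i = 0
    · simp [hw, hi]; ring
    by_cases hj : u j = 0
    · simp [hw, hj]; ring
    simp only [hw, hi, hj, if_false]
    ring
  rw [hsplit]
  refine add_nonneg (by positivity) ?_
  have ht : Tendsto (fun c : ℝ => ∑ i, ∑ j, w i * w j * (f (c + u i * u j) - f 0))
      (nhdsWithin 0 (Ioi 0)) (nhds (∑ i, ∑ j, w i * w j * (f (u i * u j) - f 0))) := by
    refine tendsto_finsetSum _ fun i _ => tendsto_finsetSum _ fun j _ => ?_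
    by_cases hi : u i = 0
    · simp [hw, hi]
    by_cases hj : u j = 0
    · simp [hw, hj]
    have hpos : 0 < u i * u j := lt_of_le_of_ne (hnn i j) (mul_ne_zero hi hj).symm
    have hcf : ContinuousAt f (0 + u i * u j) := by
      rw [zero_add]
      exact (ham β hβR).1.continuousOn.continuousAt (Ioo_mem_nhds hpos (hβ2 i j))
    have h1 : ContinuousAt (fun c : ℝ => f (c + u i * u j)) 0 :=
      ContinuousAt.comp (g := f) (f := fun c : ℝ => c + u i * u j) hcf (by fun_prop)
    have h2 := h1.tendsto.mono_left (nhdsWithin_le_nhds (s := Ioi 0))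
    rw [zero_add] at h2
    exact (h2.sub_const _).const_mul _
  refine ge_of_tendsto ht ?_
  have hev : ∀ᶠ c : ℝ in nhdsWithin 0 (Ioi 0), ∀ ij : Fin n × Fin n,
      c + u ij.1 * u ij.2 < β := by
    rw [eventually_all]
    intro ij
    have : Continuous (fun c : ℝ => c + u ij.1 * u ij.2) := by fun_prop
    have h := (this.tendsto 0).mono_left (nhdsWithin_le_nhds (s := Ioi 0))
    exact h.eventually (gt_mem_nhds (by simpa using hβ2 ij.1 ij.2))
  filter_upwards [hev, self_mem_nhdsWithin] with c h1 h2
  exact hg.psd h2 (psd_rank u) hnn (fun i j => h1 (i, j)) w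

/-- Let `0 < R ≤ ∞`, `I = [0,R)`, and `f : I → ℝ`.  Then: (a) `f[a·1 + uuᵀ]` is positive
semidefinite for all `n ≥ 1`, `a ∈ I`, `u ∈ [0,√(R-a))ⁿ` iff (b) `f` is absolutely
monotonic on `(0,R)` and `0 ≤ f(0) ≤ f⁺(0)` where `f⁺(0) = lim_{x→0⁺} f(x)` exists.
Similarly: (1) `f` is right-continuous at `0` and satisfies the condition in (a) iff
(2) `f[A]` is positive semidefinite for all `n ≥ 1` and `A ∈ P_n(I)` iff (3) `f` is
absolutely monotonic on `[0,R)`. -/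
theorem special_rank_two_preservers_nonneg_domain
    (R : EReal) (hR : 0 < R) (I : Set ℝ)
    (hI : I = {x : ℝ | 0 ≤ x ∧ (x : EReal) < R}) (f : ℝ → ℝ) :
    ((∀ n : ℕ, 1 ≤ n → ∀ a ∈ I, ∀ u : Fin n → ℝ,
        (∀ i, 0 ≤ u i ∧ ((a + u i * u i : ℝ) : EReal) < R) →
        (Matrix.of fun i j => f (a + u i * u j)).PosSemidef) ↔
      (AbsolutelyMonotonicOn f {x : ℝ | 0 < x ∧ (x : EReal) < R} ∧
        ∃ L : ℝ, Tendsto f (nhdsWithin 0 (Set.Ioi 0)) (nhds L) ∧ 0 ≤ f 0 ∧ f 0 ≤ L)) ∧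
    ((ContinuousWithinAt f (Set.Ici 0) 0 ∧
        ∀ n : ℕ, 1 ≤ n → ∀ a ∈ I, ∀ u : Fin n → ℝ,
          (∀ i, 0 ≤ u i ∧ ((a + u i * u i : ℝ) : EReal) < R) →
          (Matrix.of fun i j => f (a + u i * u j)).PosSemidef) ↔
      AbsolutelyMonotonicOn f I) ∧
    ((∀ n : ℕ, 1 ≤ n → ∀ A : Matrix (Fin n) (Fin n) ℝ, A.PosSemidef →
        (∀ i j, A i j ∈ I) → (A.map f).PosSemidef) ↔
      AbsolutelyMonotonicOn f I) := by
  subst hI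
  set J : Set ℝ := {x : ℝ | 0 < x ∧ (x : EReal) < R} with hJ
  have hJo : IsOpen J := isOpen_J R
  have hIJ : interior {x : ℝ | 0 ≤ x ∧ (x : EReal) < R} = J := interior_I R
  have hab : ∀ {g : ℝ → ℝ}, CondA R g → ∀ β : ℝ, (β : EReal) < R → Hyp g β :=
    fun h β hβ => h.hyp hβ
  have hlim : CondA R f → ∃ L : ℝ, Tendsto f (nhdsWithin 0 (Ioi 0)) (nhds L) ∧ f 0 ≤ L := by
    intro h
    obtain ⟨b, hb0, hbR⟩ := EReal.lt_iff_exists_real_btwn.1 hR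
    have hb0 : 0 < b := by exact_mod_cast hb0
    obtain ⟨b', hbb', hbR'⟩ := EReal.lt_iff_exists_real_btwn.1 hbR
    have hbb' : b < b' := by exact_mod_cast hbb'
    have hm := (h.hyp hbR').clamp_mono le_rfl hb0.le hbb'
    have hev : ∀ᶠ x in nhdsWithin 0 (Ioi 0), clampF f 0 b x = f x := by
      filter_upwards [Ioo_mem_nhdsGT hb0] with x hx using clampF_eq hx.1.le hx.2.le
    refine ⟨_, (hm.tendsto_rightLim 0).congr' hev, ?_⟩
    have := hm.le_rightLim (le_refl (0 : ℝ))
    rwa [show clampF f 0 b 0 = f 0 from clampF_eq le_rfl hb0.le] at this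
  have hf0 : CondA R f → 0 ≤ f 0 := by
    intro h
    obtain ⟨b, hb0, hbR⟩ := EReal.lt_iff_exists_real_btwn.1 hR
    exact (h.hyp hbR).nonneg le_rfl (by exact_mod_cast hb0)
  have hJam : CondA R f → ContDiffOn ℝ (⊤ : ℕ∞) f J ∧
      ∀ (k : ℕ), ∀ x ∈ J, 0 ≤ iteratedDerivWithin k f J x :=
    fun h => (amJ_iff R f).1 fun β hβ => (h.hyp hβ).ami
  have h1to3 : ContinuousWithinAt f (Ici 0) 0 → CondA R f →
      AbsolutelyMonotonicOn f {x : ℝ | 0 ≤ x ∧ (x : EReal) < R} := by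
    intro hc h
    have hj := hJam h
    refine ⟨?_, by rw [hIJ]; exact hj.1, by rw [hIJ]; exact hj.2⟩
    intro x hx
    rcases hx.1.eq_or_lt with h0 | h0
    · rw [← h0]; exact hc.mono fun y hy => hy.1
    · exact (hj.1.continuousOn.continuousAt (hJo.mem_nhds ⟨h0, hx.2⟩)).continuousWithinAt
  have h3to2 : AbsolutelyMonotonicOn f {x : ℝ | 0 ≤ x ∧ (x : EReal) < R} →
      ∀ n : ℕ, 1 ≤ n → ∀ A : Matrix (Fin n) (Fin n) ℝ, A.PosSemidef →
        (∀ i j, A i j ∈ {x : ℝ | 0 ≤ x ∧ (x : EReal) < R}) → (A.map f).PosSemidef := by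
    rintro ⟨hc, hd, hk⟩ n hn A hA hAI
    rw [hIJ] at hd hk
    have ham := (amJ_iff R f).2 ⟨hd, hk⟩
    rw [psd_iff]
    refine ⟨fun i j => by simp [((psd_iff A).1 hA).1 i j], fun v => ?_⟩
    obtain ⟨β, hβR, hβ⟩ := exists_bound R hR (fun ij : Fin n × Fin n => A ij.1 ij.2)
      (fun ij => (hAI ij.1 ij.2).2)
    have hev : ∀ᶠ c : ℝ in nhdsWithin 0 (Ioi 0), ∀ ij : Fin n × Fin n, c + A ij.1 ij.2 < β := by
      rw [eventually_all]
      intro ij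
      have : Continuous (fun c : ℝ => c + A ij.1 ij.2) := by fun_prop
      have h := (this.tendsto 0).mono_left (nhdsWithin_le_nhds (s := Ioi 0))
      exact h.eventually (gt_mem_nhds (by simpa using hβ ij))
    have ht : Tendsto (fun c : ℝ => ∑ i, ∑ j, v i * v j * f (c + A i j)) (nhdsWithin 0 (Ioi 0))
        (nhds (∑ i, ∑ j, v i * v j * f (A i j))) := by
      refine tendsto_finsetSum _ fun i _ => tendsto_finsetSum _ fun j _ => ?_
      refine Tendsto.const_mul _ ?_
      refine (hc (A i j) (hAI i j)).tendsto.comp ?_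
      refine tendsto_nhdsWithin_of_tendsto_nhds_of_eventually_within _ ?_ ?_
      · have : Continuous (fun c : ℝ => c + A i j) := by fun_prop
        simpa using (this.tendsto 0).mono_left (nhdsWithin_le_nhds (s := Ioi 0))
      · filter_upwards [hev, self_mem_nhdsWithin] with c h1 h2
        have h2 : 0 < c := h2
        exact ⟨by linarith [(hAI i j).1], lt_trans (by exact_mod_cast h1 (i, j)) hβR⟩
    refine ge_of_tendsto ht ?_
    filter_upwards [hev, self_mem_nhdsWithin] with c h1 h2
    exact (ham β hβR).psd h2 hA (fun i j => (hAI i j).1) (fun i j => h1 (i, j)) v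
  have h2toA : (∀ n : ℕ, 1 ≤ n → ∀ A : Matrix (Fin n) (Fin n) ℝ, A.PosSemidef →
        (∀ i j, A i j ∈ {x : ℝ | 0 ≤ x ∧ (x : EReal) < R}) → (A.map f).PosSemidef) →
        CondA R f := by
    intro h n hn a ha u hu
    refine h n hn (Matrix.of fun i j => a + u i * u j) (psd_const_add (psd_rank u) ha.1) ?_
    intro i j
    refine ⟨add_nonneg ha.1 (mul_nonneg (hu i).1 (hu j).1), ?_⟩
    rcases le_total (u i) (u j) with hij | hij
    · refine lt_of_le_of_lt ?_ (hu j).2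
      exact_mod_cast (add_le_add_right (mul_le_mul_of_nonneg_right hij (hu j).1) a)
    · refine lt_of_le_of_lt ?_ (hu i).2
      exact_mod_cast (add_le_add_right (mul_le_mul_of_nonneg_left hij (hu i).1) a)
  refine ⟨⟨?_, ?_⟩, ⟨?_, ?_⟩, ⟨?_, h3to2⟩⟩
  · intro h
    have hj := hJam h
    obtain ⟨L, hL, h0L⟩ := hlim h
    refine ⟨⟨hj.1.continuousOn, ?_, ?_⟩, L, hL, hf0 h, h0L⟩
    · rw [hJo.interior_eq]; exact hj.1
    · rw [hJo.interior_eq]; exact hj.2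
  · rintro ⟨⟨-, hd, hk⟩, L, hL, h0, h0L⟩
    rw [hJo.interior_eq] at hd hk
    exact condA_of R f ((amJ_iff R f).2 ⟨hd, hk⟩) hR hL h0 h0L
  · rintro ⟨hc, h⟩
    exact h1to3 hc h
  · intro h
    refine ⟨?_, h2toA (h3to2 h)⟩
    have hc := h.1 0 ⟨le_rfl, by exact_mod_cast hR⟩
    refine hc.mono_of_mem_nhdsWithin ?_
    obtain ⟨b, hb0, hbR⟩ := EReal.lt_iff_exists_real_btwn.1 hR
    have hb0 : 0 < b := by exact_mod_cast hb0
    filter_upwards [Ico_mem_nhdsGE hb0] with x hx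
    exact ⟨hx.1, lt_trans (by exact_mod_cast hx.2) hbR⟩
  · intro h
    have hA := h2toA h
    obtain ⟨L, hL, h0L⟩ := hlim hA
    refine h1to3 ?_ hA
    have hge : L ≤ f 0 := by
      obtain ⟨b, hb0, hbR⟩ := EReal.lt_iff_exists_real_btwn.1 hR
      have hb0 : 0 < b := by exact_mod_cast hb0
      have t2 : Tendsto (fun x : ℝ => f (2 * x)) (nhdsWithin 0 (Ioi 0)) (nhds L) := by
        refine hL.comp (tendsto_nhdsWithin_of_tendsto_nhds_of_eventually_within _ ?_ ?_)
        · have : Continuous (fun c : ℝ => 2 * c) := by fun_prop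
          simpa using (this.tendsto 0).mono_left (nhdsWithin_le_nhds (s := Ioi 0))
        · filter_upwards [self_mem_nhdsWithin] with x hx
          have hx : 0 < x := hx
          exact mul_pos two_pos hx
      have hin : ∀ᶠ x : ℝ in nhdsWithin 0 (Ioi 0), 0 ≤ 4 * f (2 * x) - 6 * f x + 2 * f 0 := by
        filter_upwards [Ioo_mem_nhdsGT (half_pos hb0)] with x hx
        have hA3 : (Matrix.of ![![x, x, 0], ![x, 2 * x, x], ![0, x, x]]).PosSemidef := by
          rw [psd_iff]
          constructor
          · intro i j
            fin_cases i <;> fin_cases j <;> simp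
          · intro v
            simp [Fin.sum_univ_three]
            nlinarith [mul_nonneg hx.1.le (sq_nonneg (v 0 + v 1)),
              mul_nonneg hx.1.le (sq_nonneg (v 1 + v 2))]
        have hxR : (x : EReal) < R := lt_trans (by exact_mod_cast (by linarith [hx.2] : x < b)) hbR
        have h2R : ((2 * x : ℝ) : EReal) < R :=
          lt_trans (by exact_mod_cast (by linarith [hx.2] : 2 * x < b)) hbR
        have h0R : ((0 : ℝ) : EReal) < R := by exact_mod_cast hR
        have m1 : x ∈ {x : ℝ | 0 ≤ x ∧ (x : EReal) < R} := ⟨hx.1.le, hxR⟩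
        have m2 : 2 * x ∈ {x : ℝ | 0 ≤ x ∧ (x : EReal) < R} := ⟨by linarith [hx.1], h2R⟩
        have m0 : (0 : ℝ) ∈ {x : ℝ | 0 ≤ x ∧ (x : EReal) < R} := ⟨le_rfl, h0R⟩
        have h3 := h 3 (by norm_num) _ hA3 (by
          intro i j
          fin_cases i <;> fin_cases j <;> first | exact m1 | exact m2 | exact m0)
        have h4 := ((psd_iff _).1 h3).2 ![1, -2, 1]
        simp [Fin.sum_univ_three] at h4
        linarith
      have := ge_of_tendsto (((t2.const_mul 4).sub (hL.const_mul 6)).add_const (2 * f 0)) hin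
      linarith
    have hLe : L = f 0 := le_antisymm hge h0L
    rw [hLe] at hL
    have : ContinuousWithinAt f (Ioi 0) 0 := hL
    exact continuousWithinAt_Ioi_iff_Ici.1 this
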